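/- arXiv:1911.04922 — 9 statements merged into one kernel-verified Lean document; each statement's English description precedes it below -/
import Mathlib

section
/- For every index k and all nonnegative reals p_1,…,p_K and p*_1,…,p*_K, with G_{k,l} ≥ 0 and σ² > 0, the following inequality holds: ln(Σ_{l=1}^K G_{k,l}p_l/σ² + 1) − ln(Σ_{l≠k} G_{k,l}p*_l/σ² + 1) − (Σ_{l≠k} G_{k,l}p_l/σ² + 1)/(Σ_{l≠k} G_{k,l}p*_l/σ² + 1) + 1 ≤ ln(1 + G_{k,k}p_k/(Σ_{l≠k} G_{k,l}p_l + σ²)). -/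
open Finset

/-- key inequality (Appendix A, eq. (A2)) used in the proof of Proposition 1(i). -/
theorem surrogate_log_inequality {K : ℕ} [NeZero K] (k : Fin K)
    (p pstar : Fin K → ℝ) (G : Fin K → Fin K → ℝ) (σ2 : ℝ)
    (hp : ∀ l, 0 ≤ p l) (hpstar : ∀ l, 0 ≤ pstar l)
    (hG : ∀ l, 0 ≤ G k l) (hσ : 0 < σ2) :
    Real.log ((∑ l, G k l * p l / σ2) + 1)
      - Real.log ((∑ l ∈ Finset.univ.erase k, G k l * pstar l / σ2) + 1)
      - ((∑ l ∈ Finset.univ.erase k, G k l * p l / σ2) + 1)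
          / ((∑ l ∈ Finset.univ.erase k, G k l * pstar l / σ2) + 1)
      + 1
    ≤ Real.log (1 + G k k * p k / ((∑ l ∈ Finset.univ.erase k, G k l * p l) + σ2)) := by
  have hA : 0 ≤ ∑ l ∈ Finset.univ.erase k, G k l * p l :=
    Finset.sum_nonneg fun l _ => mul_nonneg (hG l) (hp l)
  have hB : 0 ≤ ∑ l ∈ Finset.univ.erase k, G k l * pstar l :=
    Finset.sum_nonneg fun l _ => mul_nonneg (hG l) (hpstar l)
  have hc : 0 ≤ G k k * p k := mul_nonneg (hG k) (hp k)
  rw [← Finset.add_sum_erase Finset.univ (fun l => G k l * p l / σ2) (Finset.mem_univ k)]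
  simp only [← Finset.sum_div]
  generalize (∑ l ∈ Finset.univ.erase k, G k l * p l) = A at *
  generalize (∑ l ∈ Finset.univ.erase k, G k l * pstar l) = B at *
  generalize G k k * p k = c at *
  have hx : 0 < A / σ2 + 1 := by positivity
  have hy : 0 < B / σ2 + 1 := by positivity
  have hz : 0 < 1 + c / (A + σ2) := by positivity
  have e : c / σ2 + A / σ2 + 1 = (A / σ2 + 1) * (1 + c / (A + σ2)) := by
    have : A + σ2 ≠ 0 := by positivity
    field_simp
    ring
  rw [e, Real.log_mul hx.ne' hz.ne']
  have h := Real.log_le_sub_one_of_pos (div_pos hx hy)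
  rw [Real.log_div hx.ne' hy.ne'] at h
  linarith
end

section
/- (Proposition 1(i), upper bound condition.) For all p, p* ∈ ℝ^K with nonnegative entries such that g_m(p|p*) > 0, the surrogate dominates the original error function: Φ̃_m(p|p*) ≥ Φ_m(p). -/
open Finset

/-- SINR of user `k` under power allocation `p`. -/
noncomputable def sinr {K : ℕ} (G : Fin K → Fin K → ℝ) (σ2 : ℝ)
    (p : Fin K → ℝ) (k : Fin K) : ℝ :=
  G k k * p k / ((∑ l ∈ Finset.univ.erase k, G k l * p l) + σ2)

/-- The classification-error function Φ_m(p) of task m. -/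
noncomputable def Phi {K : ℕ} (G : Fin K → Fin K → ℝ) (σ2 ξ B T Dm Am am bm : ℝ)
    (Y : Finset (Fin K)) (p : Fin K → ℝ) : ℝ :=
  am * ((∑ k ∈ Y, ξ * B * T / Dm * Real.logb 2 (1 + sinr G σ2 p k)) + Am) ^ (-bm)

/-- The concave minorant g_m(p | p*) of the sample size of task m. -/
noncomputable def gm {K : ℕ} (G : Fin K → Fin K → ℝ) (σ2 ξ B T Dm Am : ℝ)
    (Y : Finset (Fin K)) (pstar p : Fin K → ℝ) : ℝ :=
  (∑ k ∈ Y, ξ * B * T / (Dm * Real.log 2) *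
    (Real.log ((∑ l, G k l * p l / σ2) + 1)
      - Real.log ((∑ l ∈ Finset.univ.erase k, G k l * pstar l / σ2) + 1)
      - ((∑ l ∈ Finset.univ.erase k, G k l * p l / σ2) + 1)
          / ((∑ l ∈ Finset.univ.erase k, G k l * pstar l / σ2) + 1)
      + 1)) + Am

/-- The surrogate function Φ̃_m(p | p*). -/
noncomputable def PhiT {K : ℕ} (G : Fin K → Fin K → ℝ) (σ2 ξ B T Dm Am am bm : ℝ)
    (Y : Finset (Fin K)) (pstar p : Fin K → ℝ) : ℝ :=
  am * (gm G σ2 ξ B T Dm Am Y pstar p) ^ (-bm)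

/-- Proposition 1(i): the surrogate dominates the original error function. -/
theorem surrogate_upper_bound {K : ℕ} [NeZero K]
    (G : Fin K → Fin K → ℝ) (σ2 ξ B T Dm Am am bm : ℝ) (Y : Finset (Fin K))
    (p pstar : Fin K → ℝ)
    (hG : ∀ i j, 0 ≤ G i j) (hGd : ∀ k, 0 < G k k) (hσ : 0 < σ2)
    (hξ : 0 < ξ) (hB : 0 < B) (hT : 0 < T) (hD : 0 < Dm) (hA : 0 < Am)
    (ha : 0 < am) (hb : 0 < bm) (hY : Y.Nonempty)
    (hp : ∀ k, 0 ≤ p k) (hpstar : ∀ k, 0 ≤ pstar k)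
    (hg : 0 < gm G σ2 ξ B T Dm Am Y pstar p) :
    Phi G σ2 ξ B T Dm Am am bm Y p ≤ PhiT G σ2 ξ B T Dm Am am bm Y pstar p := by
  unfold Phi PhiT
  refine mul_le_mul_of_nonneg_left ?_ ha.le
  refine Real.rpow_le_rpow_of_nonpos hg ?_ (by linarith)
  unfold gm
  refine add_le_add (Finset.sum_le_sum fun k _ => ?_) le_rfl
  have hlog2 : 0 < Real.log 2 := Real.log_pos (by norm_num)
  have hI : 0 ≤ ∑ l ∈ Finset.univ.erase k, G k l * p l / σ2 :=
    Finset.sum_nonneg fun l _ => div_nonneg (mul_nonneg (hG k l) (hp l)) hσ.le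
  have hJ : 0 ≤ ∑ l ∈ Finset.univ.erase k, G k l * pstar l / σ2 :=
    Finset.sum_nonneg fun l _ => div_nonneg (mul_nonneg (hG k l) (hpstar l)) hσ.le
  have hS : ∑ l, G k l * p l / σ2
      = G k k * p k / σ2 + ∑ l ∈ Finset.univ.erase k, G k l * p l / σ2 :=
    (Finset.add_sum_erase Finset.univ (fun l => G k l * p l / σ2) (Finset.mem_univ k)).symm
  have hI2 : ∑ l ∈ Finset.univ.erase k, G k l * p l
      = σ2 * ∑ l ∈ Finset.univ.erase k, G k l * p l / σ2 := by
    rw [Finset.mul_sum]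
    refine Finset.sum_congr rfl fun l _ => ?_
    field_simp
  have hx : 0 ≤ G k k * p k / σ2 := div_nonneg (mul_nonneg (hG k k) (hp k)) hσ.le
  unfold sinr
  rw [hS, hI2]
  generalize (∑ l ∈ Finset.univ.erase k, G k l * p l / σ2) = I at *
  generalize (∑ l ∈ Finset.univ.erase k, G k l * pstar l / σ2) = J at *
  have hI1 : 0 < I + 1 := by linarith
  have hJ1 : 0 < J + 1 := by linarith
  have h1 : 1 + G k k * p k / (σ2 * I + σ2) = (G k k * p k / σ2 + I + 1) / (I + 1) := by
    have : σ2 * I + σ2 = σ2 * (I + 1) := by ring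
    rw [this]
    field_simp
    ring
  have h2 := Real.log_le_sub_one_of_pos (div_pos hI1 hJ1)
  rw [Real.log_div hI1.ne' hJ1.ne'] at h2
  rw [h1, Real.logb, Real.log_div (by linarith) hI1.ne']
  have h3 : ξ * B * T / Dm * ((Real.log (G k k * p k / σ2 + I + 1) - Real.log (I + 1)) / Real.log 2)
      = ξ * B * T / (Dm * Real.log 2) *
        (Real.log (G k k * p k / σ2 + I + 1) - Real.log (I + 1)) := by
    field_simp
  rw [h3]
  refine mul_le_mul_of_nonneg_left ?_ (by positivity)
  linarith
end

section
/- (Proposition 1(ii), convexity.) For any fixed reference point p* with nonnegative entries, the surrogate function p ↦ Φ̃_m(p|p*) is convex on the convex set {p ∈ ℝ^K : p_k ≥ 0 for all k, and g_m(p|p*) > 0}. -/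
open Finset

theorem convexOn_rpow_left_neg (b : ℝ) (hb : 0 < b) :
    ConvexOn ℝ (Set.Ioi 0) (fun x : ℝ => x ^ (-b)) := by
  refine ⟨convex_Ioi 0, ?_⟩
  intro x hx y hy s t hs ht hst
  have hz : 0 < s * x + t * y := (convex_Ioi (0 : ℝ)) hx hy hs ht hst
  have hl := strictConcaveOn_log_Ioi.concaveOn.2 hx hy hs ht hst
  have he := convexOn_exp.2 (Set.mem_univ (Real.log x * -b)) (Set.mem_univ (Real.log y * -b)) hs ht hst
  simp only [smul_eq_mul] at *
  rw [Real.rpow_def_of_pos hx, Real.rpow_def_of_pos hy, Real.rpow_def_of_pos hz]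
  refine le_trans (Real.exp_le_exp.2 ?_) he
  nlinarith [mul_le_mul_of_nonneg_left hl hb.le]

/-- Proposition 1(ii): for any fixed reference point p* with nonnegative
entries, the surrogate p ↦ Φ̃_m(p | p*) is convex on
{p : p ≥ 0 componentwise and g_m(p|p*) > 0}. -/
theorem surrogate_convex {K : ℕ} [NeZero K]
    (G : Fin K → Fin K → ℝ) (σ2 ξ B T Dm Am am bm : ℝ) (Y : Finset (Fin K))
    (pstar : Fin K → ℝ)
    (hG : ∀ i j, 0 ≤ G i j) (hGd : ∀ k, 0 < G k k) (hσ : 0 < σ2)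
    (hξ : 0 < ξ) (hB : 0 < B) (hT : 0 < T) (hD : 0 < Dm) (hA : 0 < Am)
    (ha : 0 < am) (hb : 0 < bm) (hY : Y.Nonempty)
    (hpstar : ∀ k, 0 ≤ pstar k) :
    ConvexOn ℝ
      {p : Fin K → ℝ | (∀ k, 0 ≤ p k) ∧ 0 < gm G σ2 ξ B T Dm Am Y pstar p}
      (PhiT G σ2 ξ B T Dm Am am bm Y pstar) := by
  have hgc : ∀ p q : Fin K → ℝ, (∀ k, 0 ≤ p k) → (∀ k, 0 ≤ q k) → ∀ a b : ℝ, 0 ≤ a → 0 ≤ b →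
      a + b = 1 → a * gm G σ2 ξ B T Dm Am Y pstar p + b * gm G σ2 ξ B T Dm Am Y pstar q
        ≤ gm G σ2 ξ B T Dm Am Y pstar (a • p + b • q) := by
    intro p q hp hq a b ha0 hb0 hab
    unfold gm
    have hAm : Am = a * Am + b * Am := by rw [← add_mul, hab, one_mul]
    rw [mul_add, mul_add, add_add_add_comm, ← hAm]
    gcongr
    rw [Finset.mul_sum, Finset.mul_sum, ← Finset.sum_add_distrib]
    apply Finset.sum_le_sum
    intro k _
    have hc : 0 ≤ ξ * B * T / (Dm * Real.log 2) := by
      have := Real.log_pos (one_lt_two)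
      positivity
    have lin : ∀ s : Finset (Fin K), (∑ l ∈ s, G k l * (a • p + b • q) l / σ2) + 1
        = a * ((∑ l ∈ s, G k l * p l / σ2) + 1) + b * ((∑ l ∈ s, G k l * q l / σ2) + 1) := by
      intro s
      have : ∑ l ∈ s, G k l * (a • p + b • q) l / σ2
          = a * (∑ l ∈ s, G k l * p l / σ2) + b * (∑ l ∈ s, G k l * q l / σ2) := by
        rw [Finset.mul_sum, Finset.mul_sum, ← Finset.sum_add_distrib]
        apply Finset.sum_congr rfl
        intro l _
        simp only [Pi.add_apply, Pi.smul_apply, smul_eq_mul]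
        ring
      rw [this]
      linear_combination -hab
    have pos : ∀ r : Fin K → ℝ, (∀ k, 0 ≤ r k) → 0 < (∑ l, G k l * r l / σ2) + 1 := by
      intro r hr
      have : 0 ≤ ∑ l, G k l * r l / σ2 :=
        Finset.sum_nonneg fun l _ => div_nonneg (mul_nonneg (hG k l) (hr l)) hσ.le
      linarith
    rw [lin, lin]
    have hlog := strictConcaveOn_log_Ioi.concaveOn.2 (pos p hp) (pos q hq) ha0 hb0 hab
    simp only [smul_eq_mul] at hlog
    generalize Real.log (a * ((∑ l, G k l * p l / σ2) + 1) + b * ((∑ l, G k l * q l / σ2) + 1)) = L at *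
    generalize Real.log ((∑ l, G k l * p l / σ2) + 1) = L1 at *
    generalize Real.log ((∑ l, G k l * q l / σ2) + 1) = L2 at *
    generalize Real.log ((∑ l ∈ Finset.univ.erase k, G k l * pstar l / σ2) + 1) = L3 at *
    generalize ((∑ l ∈ Finset.univ.erase k, G k l * pstar l / σ2) + 1) = d at *
    generalize ((∑ l ∈ Finset.univ.erase k, G k l * p l / σ2) + 1) = u at *
    generalize ((∑ l ∈ Finset.univ.erase k, G k l * q l / σ2) + 1) = v at *
    generalize ξ * B * T / (Dm * Real.log 2) = c at *
    have e : b = 1 - a := by linarith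
    have h2 := mul_le_mul_of_nonneg_left hlog hc
    subst e
    have e2 : c * (L - L3 - (a * u + (1 - a) * v) / d + 1)
      - (a * (c * (L1 - L3 - u / d + 1)) + (1 - a) * (c * (L2 - L3 - v / d + 1)))
      = c * L - c * (a * L1 + (1 - a) * L2) := by ring
    linarith
  have hgpos : ∀ x y a b : ℝ, 0 < x → 0 < y → 0 ≤ a → 0 ≤ b → a + b = 1 → 0 < a * x + b * y := by
    intro x y a b hx hy ha0 hb0 hab
    exact (convex_Ioi (0 : ℝ)) hx hy ha0 hb0 hab
  refine ⟨?_, ?_⟩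
  · intro p hp q hq a b ha0 hb0 hab
    refine ⟨fun k => ?_, ?_⟩
    · have := hp.1 k
      have := hq.1 k
      simp only [Pi.add_apply, Pi.smul_apply, smul_eq_mul]
      positivity
    · exact lt_of_lt_of_le (hgpos _ _ a b hp.2 hq.2 ha0 hb0 hab) (hgc p q hp.1 hq.1 a b ha0 hb0 hab)
  · intro p hp q hq a b ha0 hb0 hab
    have h1 := hgc p q hp.1 hq.1 a b ha0 hb0 hab
    have h0 := hgpos _ _ a b hp.2 hq.2 ha0 hb0 hab
    have h3 := Real.rpow_le_rpow_of_nonpos h0 h1 (by linarith : -bm ≤ 0)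
    have h4 := (convexOn_rpow_left_neg bm hb).2 hp.2 hq.2 ha0 hb0 hab
    simp only [smul_eq_mul] at h4
    unfold PhiT
    have h5 := mul_le_mul_of_nonneg_left (h3.trans h4) ha.le
    simp only [smul_eq_mul]
    linarith
end

section
/- (Proposition 1(iii), local tightness.) For any p* with strictly positive entries, the surrogate coincides with the original function at p* and their gradients agree there: Φ̃_m(p*|p*) = Φ_m(p*) and ∇_p Φ̃_m(p|p*)|_{p=p*} = ∇_p Φ_m(p)|_{p=p*}. -/
open Finset

/-- Proposition 1(iii): the surrogate is tight at the reference point,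
both in value and in gradient. -/
theorem surrogate_local_tightness {K : ℕ} [NeZero K]
    (G : Fin K → Fin K → ℝ) (σ2 ξ B T Dm Am am bm : ℝ) (Y : Finset (Fin K))
    (pstar : Fin K → ℝ)
    (hG : ∀ i j, 0 ≤ G i j) (hGd : ∀ k, 0 < G k k) (hσ : 0 < σ2)
    (hξ : 0 < ξ) (hB : 0 < B) (hT : 0 < T) (hD : 0 < Dm) (hA : 0 < Am)
    (ha : 0 < am) (hb : 0 < bm) (hY : Y.Nonempty)
    (hpstar : ∀ k, 0 < pstar k) :
    PhiT G σ2 ξ B T Dm Am am bm Y pstar pstar = Phi G σ2 ξ B T Dm Am am bm Y pstar ∧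
    fderiv ℝ (PhiT G σ2 ξ B T Dm Am am bm Y pstar) pstar
      = fderiv ℝ (Phi G σ2 ξ B T Dm Am am bm Y) pstar := by
  have hSpos : ∀ (s : Finset (Fin K)) (k : Fin K), 0 < (∑ l ∈ s, G k l * pstar l / σ2) + 1 := by
    intro s k
    have : 0 ≤ ∑ l ∈ s, G k l * pstar l / σ2 :=
      Finset.sum_nonneg fun l _ => div_nonneg (mul_nonneg (hG k l) (hpstar l).le) hσ.le
    linarith
  have hdiff : ∀ (s : Finset (Fin K)) (k : Fin K),
      DifferentiableAt ℝ (fun p : Fin K → ℝ => (∑ l ∈ s, G k l * p l / σ2) + 1) pstar := by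
    intro s k
    fun_prop
  have hl2 : 0 < Real.log 2 := Real.log_pos (by norm_num)
  have key : ∀ k (p : Fin K → ℝ), 0 < (∑ l, G k l * p l / σ2) + 1 →
      0 < (∑ l ∈ Finset.univ.erase k, G k l * p l / σ2) + 1 →
      ξ * B * T / Dm * Real.logb 2 (1 + sinr G σ2 p k) =
      ξ * B * T / (Dm * Real.log 2) * (Real.log ((∑ l, G k l * p l / σ2) + 1)
        - Real.log ((∑ l ∈ Finset.univ.erase k, G k l * p l / σ2) + 1)) := by
    intro k p h1 h2
    rw [← Real.log_div h1.ne' h2.ne', Real.logb]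
    have : 1 + sinr G σ2 p k = ((∑ l, G k l * p l / σ2) + 1) /
        ((∑ l ∈ Finset.univ.erase k, G k l * p l / σ2) + 1) := by
      unfold sinr
      rw [← Finset.add_sum_erase Finset.univ _ (Finset.mem_univ k)]
      rw [← Finset.sum_div] at h2 ⊢
      generalize (∑ l ∈ Finset.univ.erase k, G k l * p l) = I at *
      have h3 : 0 < I + σ2 := by
        have := mul_pos h2 hσ
        field_simp at this
        simpa using this
      have h4 : I / σ2 + 1 = (I + σ2) / σ2 := by field_simp
      rw [add_assoc, h4]
      field_simp
      ring
    rw [this]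
    field_simp
  set F : (Fin K → ℝ) → ℝ := fun p =>
    (∑ k ∈ Y, ξ * B * T / Dm * Real.logb 2 (1 + sinr G σ2 p k)) + Am with hF
  have hval : gm G σ2 ξ B T Dm Am Y pstar pstar = F pstar := by
    simp only [hF, gm]
    congr 1
    refine Finset.sum_congr rfl fun k _ => ?_
    rw [key k pstar (hSpos _ k) (hSpos _ k), div_self (hSpos _ k).ne']
    ring
  have hpos : 0 < F pstar := by
    simp only [hF]
    have : 0 ≤ ∑ k ∈ Y, ξ * B * T / Dm * Real.logb 2 (1 + sinr G σ2 pstar k) := by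
      refine Finset.sum_nonneg fun k _ => mul_nonneg (by positivity) ?_
      refine Real.logb_nonneg (by norm_num) ?_
      have : 0 ≤ sinr G σ2 pstar k := by
        unfold sinr
        have : 0 ≤ ∑ l ∈ Finset.univ.erase k, G k l * pstar l :=
          Finset.sum_nonneg fun l _ => mul_nonneg (hG k l) (hpstar l).le
        exact div_nonneg (mul_nonneg (hG k k) (hpstar k).le) (by linarith)
      linarith
    linarith
  obtain ⟨L, hL1, hL2⟩ : ∃ L : (Fin K → ℝ) →L[ℝ] ℝ,
      HasFDerivAt (gm G σ2 ξ B T Dm Am Y pstar) L pstar ∧ HasFDerivAt F L pstar := by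
    have hS := fun k => (hdiff Finset.univ k).hasFDerivAt
    have hI := fun k => (hdiff (Finset.univ.erase k) k).hasFDerivAt
    refine ⟨_, (HasFDerivAt.fun_sum (u := Y) fun k _ =>
      (((((hS k).log (hSpos _ k).ne').sub_const
        (Real.log ((∑ l ∈ Finset.univ.erase k, G k l * pstar l / σ2) + 1))).sub
        ((hI k).mul_const ((∑ l ∈ Finset.univ.erase k, G k l * pstar l / σ2) + 1)⁻¹)).add_const
        1).const_mul (ξ * B * T / (Dm * Real.log 2))).add_const Am, ?_⟩
    refine (HasFDerivAt.fun_sum (u := Y) fun k _ => ?_).add_const Am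
    refine HasFDerivAt.congr_of_eventuallyEq
      ((((hS k).log (hSpos _ k).ne').sub ((hI k).log (hSpos _ k).ne')).const_mul
        (ξ * B * T / (Dm * Real.log 2))) ?_
    filter_upwards [(hdiff Finset.univ k).continuousAt.eventually (lt_mem_nhds (hSpos _ k)),
      (hdiff (Finset.univ.erase k) k).continuousAt.eventually (lt_mem_nhds (hSpos _ k))]
      with p h1 h2
    exact key k p h1 h2
  refine ⟨?_, ?_⟩
  · simp only [PhiT, Phi, hval, hF]
  · have e1 := (hL1.rpow_const (p := -bm) (Or.inl (by rw [hval]; exact hpos.ne'))).const_mul am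
    have e2 := (hL2.rpow_const (p := -bm) (Or.inl hpos.ne')).const_mul am
    rw [hval] at e1
    exact e1.fderiv.trans e2.fderiv.symm
end

section
/- (Proposition 2.) Suppose μ* > 0 is such that Σ_{k=1}^K p_k*(μ*) = P, where p_k*(μ) = [ (σ²/G_{k,k})·exp( (D_k ln 2/(ξBT))·[ (μ/(β_k a_k))^{−1/b_k} − A_k ] ) − σ²/G_{k,k} ]⁺. Then (p*(μ*), μ*) is optimal for problem P2: the point p*(μ*) is feasible with objective value μ*, and for every p ∈ ℝ^K with p_k ≥ 0, Σ_k p_k = P and every μ such that β_k a_k[(ξBT/D_k)log₂(1 + G_{k,k}p_k/σ²) + A_k]^{−b_k} ≤ μ for all k, one has μ* ≤ μ. -/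
open Finset

/-- The optimal power allocation of Proposition 2:
p_k*(μ) = [ (σ²/G_kk)·exp( (D_k ln2/(ξBT))·( (μ/(β_k a_k))^{-1/b_k} − A_k ) ) − σ²/G_kk ]⁺. -/
noncomputable def pkstar (Gkk σ2 ξ B T Dk Ak ak bk βk μ : ℝ) : ℝ :=
  max (σ2 / Gkk *
        Real.exp (Dk * Real.log 2 / (ξ * B * T) * ((μ / (βk * ak)) ^ (-1 / bk) - Ak))
      - σ2 / Gkk) 0

/-- Weighted classification error of user k as a function of its transmit power x:
β_k a_k [ (ξBT/D_k) log₂(1 + G_kk x/σ²) + A_k ]^{-b_k}. -/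
noncomputable def err (Gkk σ2 ξ B T Dk Ak ak bk βk x : ℝ) : ℝ :=
  βk * ak * (ξ * B * T / Dk * Real.logb 2 (1 + Gkk * x / σ2) + Ak) ^ (-bk)

lemma core_aux (g s c D A a b β μ x : ℝ) (hg : 0 < g) (hs : 0 < s) (hc : 0 < c) (hD : 0 < D)
    (hA : 0 < A) (ha : 0 < a) (hb : 0 < b) (hβ : 1 ≤ β) (hμ : 0 < μ) (hx : 0 ≤ x) :
    (β * a * (c / D * Real.logb 2 (1 + g * x / s) + A) ^ (-b) < μ ↔
      s / g * Real.exp (D * Real.log 2 / c * ((μ / (β * a)) ^ (-1 / b) - A)) - s / g < x) ∧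
    (β * a * (c / D * Real.logb 2 (1 + g * x / s) + A) ^ (-b) ≤ μ ↔
      s / g * Real.exp (D * Real.log 2 / c * ((μ / (β * a)) ^ (-1 / b) - A)) - s / g ≤ x) := by
  have hβ0 : 0 < β := by linarith
  have hca : 0 < β * a := by positivity
  have hl2 : 0 < Real.log 2 := Real.log_pos (by norm_num)
  have h1 : 1 ≤ 1 + g * x / s := by
    have : 0 ≤ g * x / s := by positivity
    linarith
  have hlog : 0 ≤ Real.logb 2 (1 + g * x / s) := Real.logb_nonneg (by norm_num) h1
  have hL : 0 < c / D * Real.logb 2 (1 + g * x / s) + A := by positivity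
  obtain ⟨y, hy⟩ : ∃ y, y = (μ / (β * a)) ^ (-1 / b) := ⟨_, rfl⟩
  have hy0 : 0 < y := by rw [hy]; positivity
  have hμy : μ = β * a * y ^ (-b) := by
    rw [hy, ← Real.rpow_mul (by positivity)]
    have : -1 / b * -b = 1 := by field_simp
    rw [this, Real.rpow_one]; field_simp
  have hx' : x = s / g * (1 + g * x / s) - s / g := by field_simp; ring
  have hLl : D * Real.log 2 / c * ((c / D * Real.logb 2 (1 + g * x / s) + A) - A)
      = Real.log (1 + g * x / s) := by
    rw [Real.logb]; field_simp; ring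
  have hk : 0 < D * Real.log 2 / c := by positivity
  have hsg : 0 < s / g := by positivity
  have hE : 1 + g * x / s = Real.exp (D * Real.log 2 / c *
      ((c / D * Real.logb 2 (1 + g * x / s) + A) - A)) := by
    rw [hLl, Real.exp_log (by linarith)]
  have hX : x = s / g * Real.exp (D * Real.log 2 / c *
      ((c / D * Real.logb 2 (1 + g * x / s) + A) - A)) - s / g := by
    rw [← hE]; exact hx'
  rw [← hy]
  generalize c / D * Real.logb 2 (1 + g * x / s) + A = L at *
  constructor
  · rw [hX, hμy, mul_lt_mul_iff_right₀ hca, sub_lt_sub_iff_right, mul_lt_mul_iff_right₀ hsg,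
      Real.exp_lt_exp, mul_lt_mul_iff_right₀ hk, sub_lt_sub_iff_right]
    exact Real.rpow_lt_rpow_iff_of_neg hL hy0 (by linarith)
  · rw [hX, hμy, mul_le_mul_iff_right₀ hca, sub_le_sub_iff_right, mul_le_mul_iff_right₀ hsg,
      Real.exp_le_exp, mul_le_mul_iff_right₀ hk, sub_le_sub_iff_right]
    exact Real.rpow_le_rpow_iff_of_neg hL hy0 (by linarith)

/-- Proposition 2: if μ* > 0 satisfies Σ_k p_k*(μ*) = P, then
(p*(μ*), μ*) is optimal for problem P2. -/
theorem prop2_optimality {K : ℕ} [NeZero K]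
    (G D A a b β : Fin K → ℝ) (σ2 ξ B T P μs : ℝ)
    (hG : ∀ k, 0 < G k) (hσ : 0 < σ2) (hξ : 0 < ξ) (hB : 0 < B) (hT : 0 < T)
    (hD : ∀ k, 0 < D k) (hA : ∀ k, 0 < A k) (ha : ∀ k, 0 < a k) (hb : ∀ k, 0 < b k)
    (hβ : ∀ k, 1 ≤ β k) (hP : 0 < P) (hμs : 0 < μs)
    (hsum : ∑ k, pkstar (G k) σ2 ξ B T (D k) (A k) (a k) (b k) (β k) μs = P) :
    (∀ k, 0 ≤ pkstar (G k) σ2 ξ B T (D k) (A k) (a k) (b k) (β k) μs) ∧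
    (∀ k, err (G k) σ2 ξ B T (D k) (A k) (a k) (b k) (β k)
        (pkstar (G k) σ2 ξ B T (D k) (A k) (a k) (b k) (β k) μs) ≤ μs) ∧
    (∀ (p : Fin K → ℝ) (μ : ℝ), (∀ k, 0 ≤ p k) → (∑ k, p k) = P →
      (∀ k, err (G k) σ2 ξ B T (D k) (A k) (a k) (b k) (β k) (p k) ≤ μ) →
      μs ≤ μ) := by
  have hc : 0 < ξ * B * T := by positivity
  refine ⟨fun k => le_max_right _ _, fun k => ?_, ?_⟩
  · exact ((core_aux (G k) σ2 (ξ * B * T) (D k) (A k) (a k) (b k) (β k) μs _ (hG k) hσ hc (hD k)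
      (hA k) (ha k) (hb k) (hβ k) hμs (le_max_right _ _)).2).2 (le_max_left _ _)
  · intro p μ hp hps herr
    by_contra! hlt
    have key : ∀ k, σ2 / G k * Real.exp (D k * Real.log 2 / (ξ * B * T) *
        ((μs / (β k * a k)) ^ (-1 / b k) - A k)) - σ2 / G k < p k := fun k =>
      ((core_aux (G k) σ2 (ξ * B * T) (D k) (A k) (a k) (b k) (β k) μs (p k) (hG k) hσ hc (hD k)
        (hA k) (ha k) (hb k) (hβ k) hμs (hp k)).1).1 (lt_of_le_of_lt (herr k) hlt)
    have hex : ∃ k, 0 < p k := by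
      by_contra! hn
      have : ∑ k, p k ≤ 0 := Finset.sum_nonpos fun k _ => hn k
      linarith
    obtain ⟨k0, hk0⟩ := hex
    have : ∑ k, pkstar (G k) σ2 ξ B T (D k) (A k) (a k) (b k) (β k) μs < ∑ k, p k :=
      Finset.sum_lt_sum (fun k _ => max_le (key k).le (hp k))
        ⟨k0, Finset.mem_univ _, max_lt (key k0) hk0⟩
    linarith
end

section
/- For any total power budget P > 0, there exists a unique μ > 0 such that Σ_{k=1}^K p_k*(μ) = P, where p_k*(μ) = [ (σ²/G_{k,k})·exp( (D_k ln 2/(ξBT))·[ (μ/(β_k a_k))^{−1/b_k} − A_k ] ) − σ²/G_{k,k} ]⁺. -/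
open Finset

noncomputable def rawp (s c A m b μ : ℝ) : ℝ := s * Real.exp (c * ((μ / m) ^ (-1 / b) - A)) - s

theorem rawp_anti {s c A m b : ℝ} (hs : 0 < s) (hc : 0 < c) (hm : 0 < m) (hb : 0 < b)
    {x y : ℝ} (hx : 0 < x) (hxy : x < y) : rawp s c A m b y < rawp s c A m b x := by
  unfold rawp
  have h : (y / m) ^ (-1 / b) < (x / m) ^ (-1 / b) :=
    Real.rpow_lt_rpow_of_neg (div_pos hx hm) (by gcongr) (div_neg_of_neg_of_pos (by norm_num) hb)
  gcongr

theorem rawp_cont {s c A m b : ℝ} (hm : 0 < m) :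
    ContinuousOn (rawp s c A m b) (Set.Ioi 0) := by
  unfold rawp
  have h : ContinuousOn (fun μ : ℝ => (μ / m) ^ (-1 / b)) (Set.Ioi 0) := by
    apply ContinuousOn.rpow_const (by fun_prop)
    intro x hx
    exact Or.inl (div_pos hx hm).ne'
  fun_prop

theorem rawp_surj {s c A m b : ℝ} (hs : 0 < s) (hc : 0 < c) (hA : 0 < A) (hm : 0 < m) (hb : 0 < b)
    {Q : ℝ} (hQ : 0 ≤ Q) : ∃ μ, 0 < μ ∧ rawp s c A m b μ = Q := by
  have h1 : 0 ≤ Real.log (1 + Q / s) := Real.log_nonneg (by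
    have : 0 ≤ Q / s := by positivity
    linarith)
  have hy : 0 < A + Real.log (1 + Q / s) / c := by positivity
  refine ⟨m * (A + Real.log (1 + Q / s) / c) ^ (-b), by positivity, ?_⟩
  unfold rawp
  rw [mul_div_cancel_left₀ _ hm.ne', ← Real.rpow_mul hy.le]
  have : -b * (-1 / b) = 1 := by field_simp
  rw [this, Real.rpow_one, add_sub_cancel_left, mul_div_cancel₀ _ hc.ne', Real.exp_log (by positivity)]
  field_simp
  ring

theorem sum_unique {K : ℕ} [NeZero K] (r : Fin K → ℝ → ℝ) (P : ℝ) (hP : 0 < P)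
    (anti : ∀ k x y, 0 < x → x < y → r k y < r k x)
    (cont : ∀ k, ContinuousOn (r k) (Set.Ioi 0))
    (surj : ∀ k Q, 0 ≤ Q → ∃ μ, 0 < μ ∧ r k μ = Q) :
    ∃! μ : ℝ, 0 < μ ∧ ∑ k, max (r k μ) 0 = P := by
  have hle : ∀ x y, 0 < x → x < y → ∀ k, max (r k y) 0 ≤ max (r k x) 0 := fun x y hx hxy k =>
    max_le_max (anti k x y hx hxy).le le_rfl
  have huniq : ∀ x y, 0 < x → x < y → ∑ k, max (r k y) 0 = P →
      ∑ k, max (r k x) 0 = P → False := by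
    intro x y hx hxy h1 h2
    have : ∃ k ∈ Finset.univ, 0 < max (r k y) 0 := by
      apply Finset.exists_lt_of_sum_lt
      simpa [h1] using hP
    obtain ⟨k, -, hk⟩ := this
    have hk' : 0 < r k y := by simpa using hk
    have hlt : ∑ k, max (r k y) 0 < ∑ k, max (r k x) 0 := by
      apply Finset.sum_lt_sum (fun k _ => hle x y hx hxy k)
      refine ⟨k, Finset.mem_univ _, ?_⟩
      rw [max_eq_left hk'.le]
      exact (anti k x y hx hxy).trans_le (le_max_left _ _)
    linarith
  have hex : ∃ μ : ℝ, 0 < μ ∧ ∑ k, max (r k μ) 0 = P := by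
    obtain ⟨L, hL, hLP⟩ := surj 0 P hP.le
    choose U hU hU0 using fun k => surj k 0 le_rfl
    have hS : ∀ k, U k ≤ ∑ j, U j := fun k =>
      Finset.single_le_sum (fun j _ => (hU j).le) (Finset.mem_univ k)
    have hS0 : 0 < ∑ j, U j := (hU 0).trans_le (hS 0)
    have hLV : L ≤ L + ∑ j, U j := by linarith
    have hc : ContinuousOn (fun μ => ∑ k, max (r k μ) 0) (Set.Icc L (L + ∑ j, U j)) := by
      apply continuousOn_finsetSum
      intro k _
      have h1 : ContinuousOn (r k) (Set.Icc L (L + ∑ j, U j)) :=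
        (cont k).mono fun x hx => lt_of_lt_of_le hL hx.1
      exact ContinuousOn.sup h1 continuousOn_const
    have hmem : P ∈ Set.Icc (∑ k, max (r k (L + ∑ j, U j)) 0) (∑ k, max (r k L) 0) := by
      constructor
      · rw [Finset.sum_eq_zero]
        · exact hP.le
        · intro k _
          apply max_eq_right
          have := anti k (U k) (L + ∑ j, U j) (hU k) (by linarith [hS k])
          rw [hU0] at this
          exact this.le
      · calc P ≤ max (r 0 L) 0 := by rw [hLP]; exact le_max_left _ _
          _ ≤ _ := Finset.single_le_sum (f := fun k => max (r k L) 0)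
              (fun j _ => le_max_right _ _) (Finset.mem_univ 0)
    obtain ⟨μ, hμ, h⟩ := intermediate_value_Icc' hLV hc hmem
    exact ⟨μ, lt_of_lt_of_le hL hμ.1, h⟩
  obtain ⟨μ, h0, h⟩ := hex
  refine ⟨μ, ⟨h0, h⟩, ?_⟩
  rintro ν ⟨hν, h'⟩
  rcases lt_trichotomy ν μ with hl | hl | hl
  · exact (huniq _ _ hν hl h h').elim
  · exact hl
  · exact (huniq _ _ h0 hl h' h).elim

/-- for any power budget P > 0 there is a unique μ > 0 with
Σ_k p_k*(μ) = P. -/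
theorem pkstar_unique_mu {K : ℕ} [NeZero K]
    (G D A a b β : Fin K → ℝ) (σ2 ξ B T P : ℝ)
    (hG : ∀ k, 0 < G k) (hσ : 0 < σ2) (hξ : 0 < ξ) (hB : 0 < B) (hT : 0 < T)
    (hD : ∀ k, 0 < D k) (hA : ∀ k, 0 < A k) (ha : ∀ k, 0 < a k) (hb : ∀ k, 0 < b k)
    (hβ : ∀ k, 1 ≤ β k) (hP : 0 < P) :
    ∃! μ : ℝ, 0 < μ ∧
      ∑ k, pkstar (G k) σ2 ξ B T (D k) (A k) (a k) (b k) (β k) μ = P := by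
  have hs : ∀ k, 0 < σ2 / G k := fun k => div_pos hσ (hG k)
  have hc : ∀ k, 0 < D k * Real.log 2 / (ξ * B * T) := fun k =>
    div_pos (mul_pos (hD k) (Real.log_pos (by norm_num))) (by positivity)
  have hm : ∀ k, 0 < β k * a k := fun k => mul_pos (by linarith [hβ k]) (ha k)
  exact sum_unique
    (fun k => rawp (σ2 / G k) (D k * Real.log 2 / (ξ * B * T)) (A k) (β k * a k) (b k)) P hP
    (fun k x y hx hxy => rawp_anti (hs k) (hc k) (hm k) (hb k) hx hxy)
    (fun k => rawp_cont (hm k))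
    (fun k Q hQ => rawp_surj (hs k) (hc k) (hA k) (hm k) (hb k) hQ)
end

section
/- (Equal-error property at the optimum of P2.) Let (p, μ) with μ > 0 be an optimal solution of problem P2. Then for every user k with p_k > 0, the error constraint is active: β_k a_k[(ξBT/D_k)log₂(1 + G_{k,k}p_k/σ²) + A_k]^{−b_k} = μ; and for every user k with p_k = 0, β_k a_k A_k^{−b_k} ≤ μ. -/
open Finset

lemma err_base_pos {G σ2 ξ B T D A x : ℝ} (hG : 0 < G) (hσ : 0 < σ2) (hξ : 0 < ξ) (hB : 0 < B)
    (hT : 0 < T) (hD : 0 < D) (hA : 0 < A) (hx : 0 ≤ x) :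
    0 < ξ * B * T / D * Real.logb 2 (1 + G * x / σ2) + A := by
  have h1 : 0 ≤ G * x / σ2 := by positivity
  have h2 : 0 ≤ Real.logb 2 (1 + G * x / σ2) :=
    Real.logb_nonneg (by norm_num) (by linarith)
  positivity

lemma err_lt {G σ2 ξ B T D A a b β x y : ℝ} (hG : 0 < G) (hσ : 0 < σ2) (hξ : 0 < ξ) (hB : 0 < B)
    (hT : 0 < T) (hD : 0 < D) (hA : 0 < A) (ha : 0 < a) (hb : 0 < b) (hβ : 1 ≤ β)
    (hx : 0 ≤ x) (hxy : x < y) :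
    err G σ2 ξ B T D A a b β y < err G σ2 ξ B T D A a b β x := by
  unfold err
  have h0 := err_base_pos hG hσ hξ hB hT hD hA hx
  have h1 : 0 ≤ G * x / σ2 := by positivity
  have h2 : G * x / σ2 < G * y / σ2 := by gcongr
  have h3 : Real.logb 2 (1 + G * x / σ2) < Real.logb 2 (1 + G * y / σ2) :=
    Real.logb_lt_logb (by norm_num) (by linarith) (by linarith)
  have hc : 0 < ξ * B * T / D := by positivity
  have h4 := mul_lt_mul_of_pos_left h3 hc
  have hba : 0 < β * a := mul_pos (by linarith) ha
  exact mul_lt_mul_of_pos_left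
    (Real.rpow_lt_rpow_of_neg h0 (by linarith) (by linarith)) hba

lemma err_cont {G σ2 ξ B T D A a b β x : ℝ} (hG : 0 < G) (hσ : 0 < σ2) (hξ : 0 < ξ) (hB : 0 < B)
    (hT : 0 < T) (hD : 0 < D) (hA : 0 < A) (hx : 0 ≤ x) :
    ContinuousAt (fun x => err G σ2 ξ B T D A a b β x) x := by
  unfold err
  have h0 := err_base_pos hG hσ hξ hB hT hD hA hx
  have h1 : 0 ≤ G * x / σ2 := by positivity
  have h2 : (1 + G * x / σ2) ≠ 0 := by linarith
  refine ContinuousAt.mul continuousAt_const (ContinuousAt.rpow_const ?_ (Or.inl h0.ne'))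
  unfold Real.logb
  have : ContinuousAt (fun x => Real.log (1 + G * x / σ2)) x :=
    ContinuousAt.log (by fun_prop) h2
  fun_prop

/-- equal-error property at the optimum of problem P2. -/
theorem equal_error_at_optimum {K : ℕ} [NeZero K]
    (G D A a b β : Fin K → ℝ) (σ2 ξ B T P μ : ℝ) (p : Fin K → ℝ)
    (hG : ∀ k, 0 < G k) (hσ : 0 < σ2) (hξ : 0 < ξ) (hB : 0 < B) (hT : 0 < T)
    (hD : ∀ k, 0 < D k) (hA : ∀ k, 0 < A k) (ha : ∀ k, 0 < a k) (hb : ∀ k, 0 < b k)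
    (hβ : ∀ k, 1 ≤ β k) (hP : 0 < P) (hμ : 0 < μ)
    -- (p, μ) is feasible for P2:
    (hfeas₁ : ∀ k, 0 ≤ p k) (hfeas₂ : ∑ k, p k = P)
    (hfeas₃ : ∀ k, err (G k) σ2 ξ B T (D k) (A k) (a k) (b k) (β k) (p k) ≤ μ)
    -- (p, μ) is optimal for P2:
    (hopt : ∀ (p' : Fin K → ℝ) (μ' : ℝ), (∀ k, 0 ≤ p' k) → (∑ k, p' k) = P →
      (∀ k, err (G k) σ2 ξ B T (D k) (A k) (a k) (b k) (β k) (p' k) ≤ μ') →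
      μ ≤ μ') :
    (∀ k, 0 < p k →
      err (G k) σ2 ξ B T (D k) (A k) (a k) (b k) (β k) (p k) = μ) ∧
    (∀ k, p k = 0 → β k * a k * A k ^ (-(b k)) ≤ μ) := by
  refine ⟨fun k hk => ?_, fun k hk => ?_⟩
  · by_contra hne
    have hlt := lt_of_le_of_ne (hfeas₃ k) hne
    have hc := err_cont (a := a k) (b := b k) (β := β k) (hG k) hσ hξ hB hT (hD k) (hA k) hk.le
    have hev := (hc.eventually_lt continuousAt_const hlt).and (lt_mem_nhds hk)
    have hev2 := (hev.filter_mono nhdsWithin_le_nhds).and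
      (self_mem_nhdsWithin : Set.Iio (p k) ∈ nhdsWithin (p k) (Set.Iio (p k)))
    obtain ⟨x, ⟨hx1, hx0⟩, hxk⟩ := hev2.exists
    have hxk : x < p k := hxk
    have hK : (0 : ℝ) < K := by exact_mod_cast Nat.pos_of_ne_zero (NeZero.ne K)
    set δ : ℝ := (p k - x) / K with hδ
    have hδ0 : 0 < δ := div_pos (by linarith) hK
    set p' : Fin K → ℝ := fun j => p j + δ - (if j = k then p k - x else 0) with hp'
    have hnn : ∀ j, 0 ≤ p' j := by
      intro j
      have := hfeas₁ j
      by_cases h : j = k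
      · subst h; simp only [hp', if_true]; linarith
      · simp only [hp', if_neg h]; linarith
    have hsum : ∑ j, p' j = P := by
      simp only [hp', Finset.sum_sub_distrib, Finset.sum_add_distrib, hfeas₂]
      simp only [Finset.sum_const, Finset.card_univ, Fintype.card_fin, Finset.sum_ite_eq',
        Finset.mem_univ, if_true, nsmul_eq_mul, hδ]
      field_simp
      ring
    have herr : ∀ j, err (G j) σ2 ξ B T (D j) (A j) (a j) (b j) (β j) (p' j) < μ := by
      intro j
      by_cases h : j = k
      · subst h
        exact (err_lt (hG j) hσ hξ hB hT (hD j) (hA j) (ha j) (hb j) (hβ j) hx0.le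
          (by simp only [hp', if_true]; linarith)).trans hx1
      · exact (err_lt (hG j) hσ hξ hB hT (hD j) (hA j) (ha j) (hb j) (hβ j) (hfeas₁ j)
          (by simp only [hp', if_neg h]; linarith)).trans_le (hfeas₃ j)
    obtain ⟨m, -, hm⟩ := Finset.exists_max_image Finset.univ
      (fun j => err (G j) σ2 ξ B T (D j) (A j) (a j) (b j) (β j) (p' j)) ⟨k, Finset.mem_univ k⟩
    exact absurd (hopt p' _ hnn hsum (fun j => hm j (Finset.mem_univ j))) (not_le.2 (herr m))
  · have := hfeas₃ k
    simpa [err, hk] using this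
end

section
/- (Lemma 1(i).) For every p with nonnegative entries satisfying β_m·Ξ_m(p) ≤ μ₀, the Euclidean norm of the gradient of Ξ_m is bounded as ‖∇_p Ξ_m(p)‖₂ ≤ (a_m b_m ξBT H_m/(D_m ln 2 · σ²))·(μ₀/(β_m a_m))^{1+1/b_m}. -/
open Finset

/-- Total number of collected samples (minus A_m) of task m in the asymptotic regime:
Σ_{k∈Y} (ξBT/D_m) log₂(1 + G_kk p_k/σ²). -/
noncomputable def Srate {K : ℕ} (G : Fin K → ℝ) (σ2 ξ B T Dm : ℝ)
    (Y : Finset (Fin K)) (p : Fin K → ℝ) : ℝ :=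
  ∑ k ∈ Y, ξ * B * T / Dm * Real.logb 2 (1 + G k * p k / σ2)

/-- Asymptotic classification error Ξ_m(p) of task m. -/
noncomputable def Xi {K : ℕ} (G : Fin K → ℝ) (σ2 ξ B T Dm Am am bm : ℝ)
    (Y : Finset (Fin K)) (p : Fin K → ℝ) : ℝ :=
  am * (Srate G σ2 ξ B T Dm Y p + Am) ^ (-bm)

/-- Partial derivative ∂Ξ_m/∂p_j (closed form, eq. (24) of the paper). -/
noncomputable def dXi {K : ℕ} (G : Fin K → ℝ) (σ2 ξ B T Dm Am am bm : ℝ)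
    (Y : Finset (Fin K)) (p : Fin K → ℝ) (j : Fin K) : ℝ :=
  -(am * bm * (ξ * B * T) * (if j ∈ Y then (1 : ℝ) else 0)
      / (Dm * Real.log 2 * (σ2 / G j + p j)))
    * (Srate G σ2 ξ B T Dm Y p + Am) ^ (-bm - 1)

/-- The constant H_m = ‖(𝟙_{Y}(1) G_11, …, 𝟙_{Y}(K) G_KK)‖₂. -/
noncomputable def Hconst {K : ℕ} (G : Fin K → ℝ) (Y : Finset (Fin K)) : ℝ :=
  Real.sqrt (∑ j, (if j ∈ Y then G j else 0) ^ 2)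

lemma Srate_nonneg {K : ℕ} (G : Fin K → ℝ) (σ2 ξ B T Dm : ℝ) (Y : Finset (Fin K))
    (p : Fin K → ℝ) (hG : ∀ k, 0 < G k) (hσ : 0 < σ2) (hξ : 0 < ξ) (hB : 0 < B) (hT : 0 < T)
    (hD : 0 < Dm) (hp : ∀ k, 0 ≤ p k) : 0 ≤ Srate G σ2 ξ B T Dm Y p := by
  unfold Srate
  refine Finset.sum_nonneg fun k _ => mul_nonneg (by positivity) ?_
  apply Real.logb_nonneg (by norm_num)
  have := div_nonneg (mul_nonneg (hG k).le (hp k)) hσ.le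
  linarith

/-- Sanity check: `dXi` really is the partial derivative of `Xi`. -/
lemma hasDerivAt_Xi {K : ℕ} (G : Fin K → ℝ) (σ2 ξ B T Dm Am am bm : ℝ) (Y : Finset (Fin K))
    (p : Fin K → ℝ) (hG : ∀ k, 0 < G k) (hσ : 0 < σ2) (hξ : 0 < ξ) (hB : 0 < B) (hT : 0 < T)
    (hD : 0 < Dm) (hA : 0 < Am) (hp : ∀ k, 0 ≤ p k) (j : Fin K) :
    HasDerivAt (fun t => Xi G σ2 ξ B T Dm Am am bm Y (Function.update p j t))
      (dXi G σ2 ξ B T Dm Am am bm Y p j) (p j) := by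
  have hS := Srate_nonneg G σ2 ξ B T Dm Y p hG hσ hξ hB hT hD hp
  have h1 : HasDerivAt (fun t => Srate G σ2 ξ B T Dm Y (Function.update p j t))
      (∑ k ∈ Y, if k = j then ξ * B * T / Dm * (1 / (Real.log 2 * (σ2 / G j + p j))) else 0)
      (p j) := by
    unfold Srate
    refine HasDerivAt.fun_sum fun k _ => ?_
    by_cases hk : k = j
    · subst hk
      simp only [Function.update_self, if_true]
      apply HasDerivAt.const_mul
      have hpos : 0 < 1 + G k * p k / σ2 := by
        have := div_nonneg (mul_nonneg (hG k).le (hp k)) hσ.le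
        linarith
      have h := ((((hasDerivAt_id (p k)).const_mul (G k)).div_const σ2).const_add 1).log
        hpos.ne'
      have h := h.div_const (Real.log 2)
      refine h.congr_deriv ?_
      have := hG k
      have := hp k
      have : 0 < Real.log 2 := Real.log_pos (by norm_num)
      have h3 : σ2 + G k * p k ≠ 0 := by positivity
      simp only [id]
      field_simp
    · simp only [Function.update_of_ne hk, if_neg hk]
      exact hasDerivAt_const _ _
  have h2 := ((h1.add_const Am).rpow_const (p := -bm)
    (Or.inl (by rw [Function.update_eq_self]; positivity))).const_mul am
  unfold Xi
  refine h2.congr_deriv ?_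
  rw [Function.update_eq_self, Finset.sum_ite_eq' Y j]
  unfold dXi
  have h3 : σ2 / G j + p j ≠ 0 := by
    have := div_pos hσ (hG j)
    have := hp j
    positivity
  have : 0 < Real.log 2 := Real.log_pos (by norm_num)
  split_ifs
  · field_simp
  · simp

/-- Lemma 1(i): Euclidean norm bound for the gradient of Ξ_m. -/
theorem gradXi_l2_bound {K : ℕ} [NeZero K]
    (G : Fin K → ℝ) (σ2 ξ B T Dm Am am bm βm μ0 : ℝ) (Y : Finset (Fin K))
    (p : Fin K → ℝ)
    (hG : ∀ k, 0 < G k) (hσ : 0 < σ2) (hξ : 0 < ξ) (hB : 0 < B) (hT : 0 < T)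
    (hD : 0 < Dm) (hA : 0 < Am) (ha : 0 < am) (hb : 0 < bm) (hβ : 1 ≤ βm)
    (hμ0 : 0 < μ0) (hY : Y.Nonempty) (hp : ∀ k, 0 ≤ p k)
    (hbound : βm * Xi G σ2 ξ B T Dm Am am bm Y p ≤ μ0) :
    Real.sqrt (∑ j, (dXi G σ2 ξ B T Dm Am am bm Y p j) ^ 2)
      ≤ am * bm * (ξ * B * T) * Hconst G Y / (Dm * Real.log 2 * σ2)
          * (μ0 / (βm * am)) ^ (1 + 1 / bm) := by
  have hS := Srate_nonneg G σ2 ξ B T Dm Y p hG hσ hξ hB hT hD hp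
  unfold Xi at hbound
  unfold dXi Hconst
  set S := Srate G σ2 ξ B T Dm Y p + Am with hSdef
  have hSpos : 0 < S := by positivity
  have hβ0 : 0 < βm := by linarith
  have hl : 0 < Real.log 2 := Real.log_pos (by norm_num)
  have h1 : S ^ (-bm) ≤ μ0 / (βm * am) := by
    rw [le_div_iff₀ (by positivity)]
    linarith
  have h2 : S ^ (-bm - 1) ≤ (μ0 / (βm * am)) ^ (1 + 1 / bm) := by
    have h3 : S ^ (-bm - 1) = (S ^ (-bm)) ^ (1 + 1 / bm) := by
      rw [← Real.rpow_mul hSpos.le]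
      congr 1
      field_simp
      ring
    rw [h3]
    exact Real.rpow_le_rpow (by positivity) h1 (by positivity)
  set R := (μ0 / (βm * am)) ^ (1 + 1 / bm) with hR
  have hR0 : 0 ≤ R := by positivity
  set C := am * bm * (ξ * B * T) / (Dm * Real.log 2 * σ2) with hC
  have hC0 : 0 ≤ C := by positivity
  have key : ∑ j, (-(am * bm * (ξ * B * T) * (if j ∈ Y then (1 : ℝ) else 0)
      / (Dm * Real.log 2 * (σ2 / G j + p j))) * S ^ (-bm - 1)) ^ 2
      ≤ (C * R) ^ 2 * ∑ j, (if j ∈ Y then G j else 0) ^ 2 := by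
    rw [Finset.mul_sum]
    refine Finset.sum_le_sum fun j _ => ?_
    split_ifs with hj
    · rw [neg_mul, neg_sq, ← mul_pow]
      have hg := hG j
      have hpj := hp j
      have h4 : am * bm * (ξ * B * T) * 1 / (Dm * Real.log 2 * (σ2 / G j + p j)) ≤ C * G j := by
        have h5 : C * G j = am * bm * (ξ * B * T) * 1 / (Dm * Real.log 2 * (σ2 / G j)) := by
          rw [hC]; field_simp
        rw [h5]
        gcongr
        linarith
      have h6 : 0 ≤ S ^ (-bm - 1) := by positivity
      refine pow_le_pow_left₀ (by positivity) ?_ 2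
      calc _ ≤ (C * G j) * R := mul_le_mul h4 h2 h6 (by positivity)
        _ = _ := by ring
    · simp
  calc _ ≤ Real.sqrt ((C * R) ^ 2 * ∑ j, (if j ∈ Y then G j else 0) ^ 2) := Real.sqrt_le_sqrt key
    _ = C * R * Real.sqrt (∑ j, (if j ∈ Y then G j else 0) ^ 2) := by
      rw [Real.sqrt_mul (by positivity), Real.sqrt_sq (by positivity)]
    _ = _ := by rw [hC]; ring
end

section
/- (Proposition 3, second smoothness inequality.) Let α, α' ∈ ℝ^M with nonnegative entries summing to 1, and let p ∈ ℝ^K have nonnegative entries with β_m·Ξ_m(p) ≤ μ₀ for all m. Then ‖Σ_{m=1}^M (α_m − α'_m) β_m ∇_p Ξ_m(p)‖_∞ ≤ L₂·‖α − α'‖₁, where L₂ = max_m (β_m a_m b_m ξBT H_m/(D_m ln 2 · σ²))·(μ₀/(β_m a_m))^{1+1/b_m}. -/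
open Finset

lemma dXi_bound {K : ℕ} (G : Fin K → ℝ) (σ2 ξ B T μ0 D A a b β : ℝ)
    (Y : Finset (Fin K)) (p : Fin K → ℝ)
    (hG : ∀ k, 0 < G k) (hσ : 0 < σ2) (hξ : 0 < ξ) (hB : 0 < B) (hT : 0 < T)
    (hμ0 : 0 < μ0) (hD : 0 < D) (hA : 0 < A) (ha : 0 < a) (hb : 0 < b) (hβ : 1 ≤ β)
    (hp : ∀ k, 0 ≤ p k)
    (hbound : β * Xi G σ2 ξ B T D A a b Y p ≤ μ0) (j : Fin K) :
    β * |dXi G σ2 ξ B T D A a b Y p j| ≤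
      β * a * b * (ξ * B * T) * Hconst G Y / (D * Real.log 2 * σ2)
            * (μ0 / (β * a)) ^ (1 + 1 / b) := by
  have hβ0 : 0 < β := by linarith
  have hl : 0 < Real.log 2 := Real.log_pos (by norm_num)
  have hS0 : 0 ≤ Srate G σ2 ξ B T D Y p := by
    unfold Srate
    refine Finset.sum_nonneg fun k _ => mul_nonneg (by positivity) ?_
    refine Real.logb_nonneg (by norm_num) ?_
    have : 0 ≤ G k * p k / σ2 := div_nonneg (mul_nonneg (hG k).le (hp k)) hσ.le
    linarith
  have hS : 0 < Srate G σ2 ξ B T D Y p + A := by linarith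
  unfold Xi at hbound
  unfold dXi
  set S := Srate G σ2 ξ B T D Y p + A
  have h1 : S ^ (-b) ≤ μ0 / (β * a) := by
    rw [le_div_iff₀ (by positivity)]
    linarith
  have h2 : S ^ (-b - 1) ≤ (μ0 / (β * a)) ^ (1 + 1 / b) := by
    have : S ^ (-b - 1) = (S ^ (-b)) ^ (1 + 1 / b) := by
      rw [← Real.rpow_mul hS.le]
      congr 1
      field_simp
      ring
    rw [this]
    exact Real.rpow_le_rpow (by positivity) h1 (by positivity)
  have hH0 : 0 ≤ Hconst G Y := Real.sqrt_nonneg _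
  rw [abs_mul, abs_neg, abs_of_pos (Real.rpow_pos_of_pos hS _), ← mul_assoc]
  refine mul_le_mul ?_ h2 (by positivity) (by positivity)
  by_cases hj : j ∈ Y
  · have hH : G j ≤ Hconst G Y := by
      unfold Hconst
      apply Real.le_sqrt_of_sq_le
      have := Finset.single_le_sum (f := fun i => (if i ∈ Y then G i else 0) ^ 2)
        (fun i _ => sq_nonneg _) (Finset.mem_univ j)
      simpa [hj] using this
    have hGj := hG j
    have hpj := hp j
    have h3 : 1 / (σ2 / G j + p j) ≤ Hconst G Y / σ2 := by
      calc 1 / (σ2 / G j + p j) ≤ 1 / (σ2 / G j) :=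
            one_div_le_one_div_of_le (by positivity) (by linarith)
        _ = G j / σ2 := by rw [one_div_div]
        _ ≤ _ := by gcongr
    rw [if_pos hj, abs_of_nonneg (by positivity)]
    calc _ = (β * a * b * (ξ * B * T) / (D * Real.log 2)) * (1 / (σ2 / G j + p j)) := by
          field_simp
      _ ≤ (β * a * b * (ξ * B * T) / (D * Real.log 2)) * (Hconst G Y / σ2) := by gcongr
      _ = _ := by field_simp
  · rw [if_neg hj]
    simp only [mul_zero, zero_div, abs_zero]
    positivity

/-- Proposition 3, second smoothness inequality. -/
theorem smoothness_L2_alpha {K M : ℕ} [NeZero K] [NeZero M]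
    (G : Fin K → ℝ) (σ2 ξ B T μ0 : ℝ)
    (Y : Fin M → Finset (Fin K)) (D A a b β : Fin M → ℝ)
    (α α' : Fin M → ℝ) (p : Fin K → ℝ)
    (hG : ∀ k, 0 < G k) (hσ : 0 < σ2) (hξ : 0 < ξ) (hB : 0 < B) (hT : 0 < T)
    (hμ0 : 0 < μ0)
    (hY : ∀ m, (Y m).Nonempty) (hD : ∀ m, 0 < D m) (hA : ∀ m, 0 < A m)
    (ha : ∀ m, 0 < a m) (hb : ∀ m, 0 < b m) (hβ : ∀ m, 1 ≤ β m)
    (hα : ∀ m, 0 ≤ α m) (hα1 : ∑ m, α m = 1)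
    (hα' : ∀ m, 0 ≤ α' m) (hα'1 : ∑ m, α' m = 1)
    (hp : ∀ k, 0 ≤ p k)
    (hbound : ∀ m, β m * Xi G σ2 ξ B T (D m) (A m) (a m) (b m) (Y m) p ≤ μ0) :
    ‖(fun j => ∑ m, (α m - α' m) * β m *
        dXi G σ2 ξ B T (D m) (A m) (a m) (b m) (Y m) p j : Fin K → ℝ)‖
      ≤ (Finset.univ.sup' Finset.univ_nonempty (fun m : Fin M =>
          β m * a m * b m * (ξ * B * T) * Hconst G (Y m) / (D m * Real.log 2 * σ2)
            * (μ0 / (β m * a m)) ^ (1 + 1 / b m)))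
        * ∑ m, |α m - α' m| := by
  set f := (fun m : Fin M =>
          β m * a m * b m * (ξ * B * T) * Hconst G (Y m) / (D m * Real.log 2 * σ2)
            * (μ0 / (β m * a m)) ^ (1 + 1 / b m)) with hf
  have key : ∀ j m, β m * |dXi G σ2 ξ B T (D m) (A m) (a m) (b m) (Y m) p j| ≤
      Finset.univ.sup' Finset.univ_nonempty f := fun j m =>
    (dXi_bound G σ2 ξ B T μ0 (D m) (A m) (a m) (b m) (β m) (Y m) p hG hσ hξ hB hT hμ0
      (hD m) (hA m) (ha m) (hb m) (hβ m) hp (hbound m) j).trans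
      (Finset.le_sup' f (Finset.mem_univ m))
  have hnn : 0 ≤ Finset.univ.sup' Finset.univ_nonempty f :=
    (mul_nonneg (by linarith [hβ 0]) (abs_nonneg _)).trans (key 0 0)
  rw [pi_norm_le_iff_of_nonneg (mul_nonneg hnn (Finset.sum_nonneg fun _ _ => abs_nonneg _))]
  intro j
  rw [Real.norm_eq_abs, Finset.mul_sum]
  refine (Finset.abs_sum_le_sum_abs _ _).trans (Finset.sum_le_sum fun m _ => ?_)
  have hβm : 0 ≤ β m := by linarith [hβ m]
  rw [abs_mul, abs_mul, abs_of_nonneg hβm, mul_assoc, mul_comm]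
  exact mul_le_mul_of_nonneg_right (key j m) (abs_nonneg _)
end
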